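/- arXiv:1810.12143 — 7 statements merged into one kernel-verified Lean document; each statement's English description precedes it below -/
import Mathlib

section
/- Let D ⊆ ℝ be an interval, n ≥ 1, and A : D → Matrix (Fin n) (Fin n) ℂ be continuous (entrywise). If Φ : D → Matrix (Fin n) (Fin n) ℂ is differentiable on D and satisfies the matrix ODE Φ'(x) = A(x) · Φ(x) for all x ∈ D, then for all x, x₀ ∈ D one has det Φ(x) = det Φ(x₀) · exp(∫_{x₀}^{x} trace A(ξ) dξ). -/
open MeasureTheory

theorem det_deriv_aux {n : ℕ} (M : ℝ → Matrix (Fin n) (Fin n) ℂ) (A : Matrix (Fin n) (Fin n) ℂ)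
    (D : Set ℝ) (x : ℝ)
    (h : ∀ i j, HasDerivWithinAt (fun y => M y i j) ((A * M x) i j) D x) :
    HasDerivWithinAt (fun y => (M y).det) (A.trace * (M x).det) D x := by
  have h1 : HasDerivWithinAt (fun y => ∑ σ : Equiv.Perm (Fin n), ((Equiv.Perm.sign σ : ℤ) : ℂ) *
      ∏ i, M y i (σ i))
      (∑ σ : Equiv.Perm (Fin n), ((Equiv.Perm.sign σ : ℤ) : ℂ) *
      ∑ i, (∏ j ∈ Finset.univ.erase i, M x j (σ j)) • ((A * M x) i (σ i))) D x := by
    refine HasDerivWithinAt.fun_sum fun σ _ => ?_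
    refine HasDerivWithinAt.const_mul _ ?_
    exact HasDerivWithinAt.fun_finset_prod fun i _ => h i (σ i)
  have e (N : Matrix (Fin n) (Fin n) ℂ) : N.det = ∑ σ : Equiv.Perm (Fin n),
      ((Equiv.Perm.sign σ : ℤ) : ℂ) * ∏ i, N i (σ i) := by
    rw [← Matrix.det_transpose, Matrix.det_apply']; rfl
  have key : A.trace * (M x).det = ∑ σ : Equiv.Perm (Fin n), ((Equiv.Perm.sign σ : ℤ) : ℂ) *
      ∑ i, (∏ j ∈ Finset.univ.erase i, M x j (σ j)) • ((A * M x) i (σ i)) := by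
    simp_rw [Finset.mul_sum]
    rw [Finset.sum_comm, Matrix.trace, Finset.sum_mul]
    refine Finset.sum_congr rfl fun i _ => ?_
    have := Matrix.det_updateRow_sum (M x) i (A i)
    rw [Matrix.diag_apply, ← smul_eq_mul, ← this, e]
    refine Finset.sum_congr rfl fun σ _ => ?_
    congr 1
    rw [← Finset.prod_erase_mul _ _ (Finset.mem_univ i), smul_eq_mul]
    congr 1
    · refine Finset.prod_congr rfl fun j hj => ?_
      rw [Matrix.updateRow_ne (Finset.ne_of_mem_erase hj)]
    · simp [Matrix.mul_apply, Matrix.updateRow_self]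
  rw [key]
  simpa only [e] using h1

theorem liouville_aux
    (D : Set ℝ) (hD : D.OrdConnected) (n : ℕ)
    (A Φ : ℝ → Matrix (Fin n) (Fin n) ℂ)
    (hA : ∀ i j, ContinuousOn (fun x => A x i j) D)
    (hΦ : ∀ x ∈ D, ∀ i j, HasDerivWithinAt (fun y => Φ y i j) ((A x * Φ x) i j) D x)
    (a b : ℝ) (ha : a ∈ D) (hb : b ∈ D) (hab : a ≤ b) :
      (Φ b).det = (Φ a).det * Complex.exp (∫ ξ in a..b, (A ξ).trace) := by
  have hs : Set.Icc a b ⊆ D := hD.out ha hb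
  have ht : ContinuousOn (fun x => (A x).trace) (Set.Icc a b) := by
    simp only [Matrix.trace, Matrix.diag_apply]
    exact continuousOn_finset_sum _ fun i _ => (hA i i).mono hs
  set g : ℝ → ℂ := Set.IccExtend hab ((Set.Icc a b).restrict fun x => (A x).trace) with hg
  have hgc : Continuous g := (continuousOn_iff_continuous_restrict.1 ht).Icc_extend'
  have hge : ∀ x ∈ Set.Icc a b, g x = (A x).trace := fun x hx => by
    rw [hg, Set.IccExtend_of_mem _ _ hx]; rfl
  have hint : ∫ ξ in a..b, (A ξ).trace = ∫ ξ in a..b, g ξ :=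
    intervalIntegral.integral_congr fun x hx => by
      rw [Set.uIcc_of_le hab] at hx; exact (hge x hx).symm
  have hF (y : ℝ) : HasDerivAt (fun y => ∫ ξ in a..y, g ξ) (g y) y :=
    (hgc.integral_hasStrictDerivAt a y).hasDerivAt
  have hder : ∀ y ∈ Set.Icc a b, HasDerivWithinAt
      (fun y => (Φ y).det * Complex.exp (-∫ ξ in a..y, g ξ)) 0 (Set.Icc a b) y := by
    intro y hy
    have h1 := (det_deriv_aux Φ (A y) D y (hΦ y (hs hy))).mono hs
    have h2 := ((hF y).neg.cexp).hasDerivWithinAt (s := Set.Icc a b)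
    refine (h1.mul h2).congr_deriv ?_
    rw [hge y hy]; simp only [Pi.neg_apply]; ring
  have hc := constant_of_has_deriv_right_zero (fun y hy => (hder y hy).continuousWithinAt)
    (fun y hy => (hder y (Set.Ico_subset_Icc_self hy)).mono_of_mem_nhdsWithin
      (Icc_mem_nhdsGE_of_mem hy)) b (Set.right_mem_Icc.2 hab)
  simp only [intervalIntegral.integral_same, neg_zero, Complex.exp_zero, mul_one] at hc
  rw [hint, ← hc, mul_assoc, ← Complex.exp_add]
  simp

/-- **Liouville's formula.** If `Φ` is a matrix-valued solution of the linear ODE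
`Φ' = A x * Φ` on an interval `D` with `A` continuous (entrywise), then
`det Φ x = det Φ x₀ * exp (∫_{x₀}^x trace (A ξ) dξ)` for all `x, x₀ ∈ D`. -/
theorem liouville_formula
    (D : Set ℝ) (hD : D.OrdConnected) (n : ℕ) (hn : 1 ≤ n)
    (A Φ : ℝ → Matrix (Fin n) (Fin n) ℂ)
    (hA : ∀ i j, ContinuousOn (fun x => A x i j) D)
    (hΦ : ∀ x ∈ D, ∀ i j, HasDerivWithinAt (fun y => Φ y i j) ((A x * Φ x) i j) D x) :
    ∀ x ∈ D, ∀ x₀ ∈ D,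
      (Φ x).det = (Φ x₀).det * Complex.exp (∫ ξ in x₀..x, (A ξ).trace) := by
  intro x hx x₀ hx₀
  rcases le_total x₀ x with h | h
  · exact liouville_aux D hD n A Φ hA hΦ x₀ x hx₀ hx h
  · rw [liouville_aux D hD n A Φ hA hΦ x x₀ hx hx₀ h, intervalIntegral.integral_symm x x₀,
      mul_assoc, ← Complex.exp_add]
    simp
end

section
/- Let q : ℝ × ℝ → ℝ be smooth (C³ suffices). Then the following are equivalent: (i) q satisfies the nonlocal mKdV equation q_t(x,t) − 6σ q(−x,−t) q(x,t) q_x(x,t) + q_{xxx}(x,t) = 0 for all (x,t) ∈ ℝ²; (ii) the zero-curvature equation ∂_t X(x,t;z) − ∂_x T(x,t;z) + X(x,t;z) T(x,t;z) − T(x,t;z) X(x,t;z) = 0 holds for all (x,t) ∈ ℝ² and all z ∈ ℂ \ {0}. -/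
/-- `k(z) = (z + δσ q₀²/z)/2`. -/
noncomputable def kfun (δ σ q₀ : ℝ) (z : ℂ) : ℂ :=
  (z + (δ : ℂ) * (σ : ℂ) * (q₀ : ℂ) ^ 2 / z) / 2

/-- `λ(z) = (z − δσ q₀²/z)/2`. -/
noncomputable def lamfun (δ σ q₀ : ℝ) (z : ℂ) : ℂ :=
  (z - (δ : ℂ) * (σ : ℂ) * (q₀ : ℂ) ^ 2 / z) / 2

def pauli1 : Matrix (Fin 2) (Fin 2) ℂ := !![0, 1; 1, 0]

def pauli2 : Matrix (Fin 2) (Fin 2) ℂ := !![0, -Complex.I; Complex.I, 0]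

def pauli3 : Matrix (Fin 2) (Fin 2) ℂ := !![1, 0; 0, -1]

/-- Potential matrix `Q(x,t) = [[0, q(x,t)], [σ q(−x,−t), 0]]`. -/
noncomputable def Qmat (σ : ℝ) (q : ℝ → ℝ → ℝ) (x t : ℝ) : Matrix (Fin 2) (Fin 2) ℂ :=
  !![0, (q x t : ℂ); (σ : ℂ) * (q (-x) (-t) : ℂ), 0]

/-- `Q_x`, the entrywise partial `x`-derivative of `Q`. -/
noncomputable def Qxmat (σ : ℝ) (q : ℝ → ℝ → ℝ) (x t : ℝ) : Matrix (Fin 2) (Fin 2) ℂ :=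
  Matrix.of fun i j => deriv (fun y => Qmat σ q y t i j) x

/-- `Q_{xx}`, the entrywise second partial `x`-derivative of `Q`. -/
noncomputable def Qxxmat (σ : ℝ) (q : ℝ → ℝ → ℝ) (x t : ℝ) : Matrix (Fin 2) (Fin 2) ℂ :=
  Matrix.of fun i j => deriv (fun y => Qxmat σ q y t i j) x

/-- Lax matrix `X(x,t;z) = i k(z) σ₃ + Q(x,t)`. -/
noncomputable def Xlax (δ σ q₀ : ℝ) (q : ℝ → ℝ → ℝ) (x t : ℝ) (z : ℂ) :
    Matrix (Fin 2) (Fin 2) ℂ :=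
  (Complex.I * kfun δ σ q₀ z) • pauli3 + Qmat σ q x t

/-- Lax matrix
`T = (4k² + 2σ q(x,t) q(−x,−t)) X − 2 i k σ₃ Q_x + [Q_x, Q] − Q_{xx}`. -/
noncomputable def Tlax (δ σ q₀ : ℝ) (q : ℝ → ℝ → ℝ) (x t : ℝ) (z : ℂ) :
    Matrix (Fin 2) (Fin 2) ℂ :=
  (4 * kfun δ σ q₀ z ^ 2 + 2 * (σ : ℂ) * (q x t : ℂ) * (q (-x) (-t) : ℂ)) •
      Xlax δ σ q₀ q x t z
    - (2 * Complex.I * kfun δ σ q₀ z) • (pauli3 * Qxmat σ q x t)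
    + (Qxmat σ q x t * Qmat σ q x t - Qmat σ q x t * Qxmat σ q x t)
    - Qxxmat σ q x t

theorem aux_derivs (f : ℝ → ℝ) (hf : ContDiff ℝ (⊤ : ℕ∞) f) (x : ℝ) :
    HasDerivAt f (deriv f x) x ∧ HasDerivAt (deriv f) (deriv (deriv f) x) x ∧
    HasDerivAt (deriv (deriv f)) (iteratedDeriv 3 f x) x := by
  have h1 : ContDiff ℝ (⊤ : ℕ∞) (deriv f) := (contDiff_infty_iff_deriv.1 hf).2
  have h2 : ContDiff ℝ (⊤ : ℕ∞) (deriv (deriv f)) := (contDiff_infty_iff_deriv.1 h1).2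
  refine ⟨(hf.differentiable (by simp) x).hasDerivAt,
    (h1.differentiable (by simp) x).hasDerivAt, ?_⟩
  have := (h2.differentiable (by simp) x).hasDerivAt
  rw [iteratedDeriv_succ, iteratedDeriv_succ, iteratedDeriv_one]
  exact this

theorem aux_neg {f : ℝ → ℝ} {f' : ℝ} {x : ℝ} (c : ℂ) (h : HasDerivAt f f' (-x)) :
    HasDerivAt (fun y => c * ((f (-y) : ℝ) : ℂ)) (-c * (f' : ℂ)) x := by
  have h2 : HasDerivAt (fun y => f (-y)) (f' * (-1)) x :=
    HasDerivAt.comp x h (hasDerivAt_neg x)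
  have := (h2.ofReal_comp).const_mul c
  rw [show -c * (f' : ℂ) = c * ((f' * (-1) : ℝ) : ℂ) by push_cast; ring]
  exact this

theorem aux_matrix (σ δ q₀ : ℝ) (q : ℝ → ℝ → ℝ)
    (hq : ContDiff ℝ (⊤ : ℕ∞) fun p : ℝ × ℝ => q p.1 p.2) (x t : ℝ) (z : ℂ) :
    (Matrix.of fun i j => deriv (fun s => Xlax δ σ q₀ q x s z i j) t)
            - (Matrix.of fun i j => deriv (fun y => Tlax δ σ q₀ q y t z i j) x)
            + Xlax δ σ q₀ q x t z * Tlax δ σ q₀ q x t z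
            - Tlax δ σ q₀ q x t z * Xlax δ σ q₀ q x t z =
    !![0, ((deriv (fun s => q x s) t
          - 6 * σ * q (-x) (-t) * q x t * deriv (fun y => q y t) x
          + iteratedDeriv 3 (fun y => q y t) x : ℝ) : ℂ);
      ((-σ * (deriv (fun s => q (-x) s) (-t)
          - 6 * σ * q x t * q (-x) (-t) * deriv (fun y => q y (-t)) (-x)
          + iteratedDeriv 3 (fun y => q y (-t)) (-x)) : ℝ) : ℂ), 0] := by
  have hx : ∀ t, ContDiff ℝ (⊤ : ℕ∞) (fun y => q y t) := fun t =>
    hq.comp (contDiff_id.prodMk contDiff_const)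
  have ht : ∀ x, ContDiff ℝ (⊤ : ℕ∞) (fun s => q x s) := fun x =>
    hq.comp (contDiff_const.prodMk contDiff_id)
  obtain ⟨A1, hA1⟩ : ∃ A : ℝ → ℝ → ℝ, A = fun t => deriv (fun y => q y t) := ⟨_, rfl⟩
  obtain ⟨A2, hA2⟩ : ∃ A : ℝ → ℝ → ℝ, A = fun t => deriv (deriv (fun y => q y t)) := ⟨_, rfl⟩
  obtain ⟨A3, hA3⟩ : ∃ A : ℝ → ℝ → ℝ, A = fun t => iteratedDeriv 3 (fun y => q y t) := ⟨_, rfl⟩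
  have d0 : ∀ t x, HasDerivAt (fun y => q y t) (A1 t x) x := fun t x => by
    rw [hA1]; exact (aux_derivs _ (hx t) x).1
  have d1 : ∀ t x, HasDerivAt (A1 t) (A2 t x) x := fun t x => by
    rw [hA1, hA2]; exact (aux_derivs _ (hx t) x).2.1
  have d2 : ∀ t x, HasDerivAt (A2 t) (A3 t x) x := fun t x => by
    rw [hA2, hA3]; exact (aux_derivs _ (hx t) x).2.2
  have e1 : ∀ t x, deriv (fun y => q y t) x = A1 t x := fun t x => by rw [hA1]
  have e3 : ∀ t x, iteratedDeriv 3 (fun y => q y t) x = A3 t x := fun t x => by rw [hA3]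
  rw [e1, e1, e3, e3]
  clear e1 e3 hA1 hA2 hA3
  have hQx : ∀ x, Qxmat σ q x t =
      !![0, (A1 t x : ℂ); -(σ : ℂ) * (A1 (-t) (-x) : ℂ), 0] := by
    intro x
    ext i j
    fin_cases i <;> fin_cases j
    · exact deriv_const _ _
    · exact (d0 t x).ofReal_comp.deriv
    · exact (aux_neg σ (d0 (-t) (-x))).deriv
    · exact deriv_const _ _
  have hQxx : ∀ x, Qxxmat σ q x t =
      !![0, (A2 t x : ℂ); (σ : ℂ) * (A2 (-t) (-x) : ℂ), 0] := by
    intro x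
    ext i j
    unfold Qxxmat
    simp only [hQx]
    fin_cases i <;> fin_cases j
    · exact deriv_const _ _
    · exact (d1 t x).ofReal_comp.deriv
    · have := (aux_neg (-σ : ℂ) (d1 (-t) (-x))).deriv
      rw [neg_neg] at this
      exact this
    · exact deriv_const _ _
  obtain ⟨k, hk⟩ : ∃ k, k = kfun δ σ q₀ z := ⟨_, rfl⟩
  have hX : ∀ x t, Xlax δ σ q₀ q x t z =
      !![Complex.I * k, (q x t : ℂ); (σ : ℂ) * (q (-x) (-t) : ℂ), -(Complex.I * k)] := by
    intro x t
    ext i j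
    fin_cases i <;> fin_cases j <;> simp [Xlax, Qmat, pauli3, hk]
  have hT : ∀ x, Tlax δ σ q₀ q x t z =
      !![(4 * k ^ 2 + 2 * ((q x t : ℂ) * ((σ : ℂ) * (q (-x) (-t) : ℂ)))) * (Complex.I * k)
          + ((A1 t x : ℂ) * ((σ : ℂ) * (q (-x) (-t) : ℂ))
            - (q x t : ℂ) * (-(σ : ℂ) * (A1 (-t) (-x) : ℂ))),
        (4 * k ^ 2 + 2 * ((q x t : ℂ) * ((σ : ℂ) * (q (-x) (-t) : ℂ)))) * (q x t : ℂ)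
          - 2 * Complex.I * k * (A1 t x : ℂ) - (A2 t x : ℂ);
        (4 * k ^ 2 + 2 * ((q x t : ℂ) * ((σ : ℂ) * (q (-x) (-t) : ℂ)))) *
            ((σ : ℂ) * (q (-x) (-t) : ℂ))
          + 2 * Complex.I * k * (-(σ : ℂ) * (A1 (-t) (-x) : ℂ))
          - (σ : ℂ) * (A2 (-t) (-x) : ℂ),
        -((4 * k ^ 2 + 2 * ((q x t : ℂ) * ((σ : ℂ) * (q (-x) (-t) : ℂ)))) * (Complex.I * k)
          + ((A1 t x : ℂ) * ((σ : ℂ) * (q (-x) (-t) : ℂ))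
            - (q x t : ℂ) * (-(σ : ℂ) * (A1 (-t) (-x) : ℂ))))] := by
    intro x
    unfold Tlax
    rw [hX, hQx, hQxx, ← hk, Qmat, pauli3]
    ext i j
    fin_cases i <;> fin_cases j <;> simp [Matrix.mul_apply, Fin.sum_univ_two,
      -mul_eq_mul_right_iff, -mul_eq_mul_left_iff, -mul_eq_zero] <;> ring
  have a0 := (d0 t x).ofReal_comp
  have a1 := (d1 t x).ofReal_comp
  have a2 := (d2 t x).ofReal_comp
  have b0 := aux_neg (σ : ℂ) (d0 (-t) (-x))
  have b1 := aux_neg (-σ : ℂ) (d1 (-t) (-x))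
  have b2 := aux_neg (σ : ℂ) (d2 (-t) (-x))
  have c := ((a0.mul b0).const_mul 2).const_add (4 * k ^ 2)
  have t00 := (c.mul_const (Complex.I * k)).add ((a1.mul b0).sub (a0.mul b1))
  have t01 := ((c.mul a0).sub (a1.const_mul (2 * Complex.I * k))).sub a2
  have t10 := ((c.mul b0).add (b1.const_mul (2 * Complex.I * k))).sub b2
  have t11 := t00.neg
  have s0 := ((ht x).differentiable (by simp) t).hasDerivAt.ofReal_comp
  have s1 := aux_neg (σ : ℂ) ((ht (-x)).differentiable (by simp) (-t)).hasDerivAt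
  have hXt : (Matrix.of fun i j => deriv (fun s => Xlax δ σ q₀ q x s z i j) t) =
      !![0, ((deriv (fun s => q x s) t : ℝ) : ℂ);
        -(σ : ℂ) * ((deriv (fun s => q (-x) s) (-t) : ℝ) : ℂ), 0] := by
    simp only [hX]
    ext i j
    fin_cases i <;> fin_cases j
    · exact deriv_const _ _
    · exact s0.deriv
    · exact s1.deriv
    · exact deriv_const _ _
  have hTx : (Matrix.of fun i j => deriv (fun y => Tlax δ σ q₀ q y t z i j) x) =
      !![deriv (fun y => Tlax δ σ q₀ q y t z 0 0) x, deriv (fun y => Tlax δ σ q₀ q y t z 0 1) x; deriv (fun y => Tlax δ σ q₀ q y t z 1 0) x, deriv (fun y => Tlax δ σ q₀ q y t z 1 1) x] := by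
    ext i j
    fin_cases i <;> fin_cases j <;> rfl
  have w00 : deriv (fun y => Tlax δ σ q₀ q y t z 0 0) x = _ :=
    Eq.trans (congrArg (fun f => deriv f x)
      (funext fun y => congrFun (congrFun (hT y) 0) 0)) t00.deriv
  have w01 : deriv (fun y => Tlax δ σ q₀ q y t z 0 1) x = _ :=
    Eq.trans (congrArg (fun f => deriv f x)
      (funext fun y => congrFun (congrFun (hT y) 0) 1)) t01.deriv
  have w10 : deriv (fun y => Tlax δ σ q₀ q y t z 1 0) x = _ :=
    Eq.trans (congrArg (fun f => deriv f x)
      (funext fun y => congrFun (congrFun (hT y) 1) 0)) t10.deriv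
  have w11 : deriv (fun y => Tlax δ σ q₀ q y t z 1 1) x = _ :=
    Eq.trans (congrArg (fun f => deriv f x)
      (funext fun y => congrFun (congrFun (hT y) 1) 1)) t11.deriv
  rw [hXt, hTx, w00, w01, w10, w11, hX, hT]
  have hI : Complex.I ^ 2 = -1 := Complex.I_sq
  ext i j
  fin_cases i <;> fin_cases j <;> simp [Matrix.mul_apply, Fin.sum_univ_two,
      -mul_eq_mul_right_iff, -mul_eq_mul_left_iff, -mul_eq_zero] <;> ring_nf <;>
    simp only [hI] <;> ring

/-- The nonlocal mKdV equation
`q_t − 6σ q(−x,−t) q(x,t) q_x + q_{xxx} = 0` holds iff the zero-curvature equation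
`X_t − T_x + X T − T X = 0` holds for all `(x,t)` and all `z ≠ 0`. -/
theorem nonlocal_mkdv_iff_zero_curvature
    (q₀ δ σ : ℝ) (hq₀ : 0 < q₀) (hδ : δ = 1 ∨ δ = -1) (hσ : σ = 1 ∨ σ = -1)
    (q : ℝ → ℝ → ℝ) (hq : ContDiff ℝ (⊤ : ℕ∞) fun p : ℝ × ℝ => q p.1 p.2) :
    (∀ x t : ℝ,
        deriv (fun s => q x s) t
          - 6 * σ * q (-x) (-t) * q x t * deriv (fun y => q y t) x
          + iteratedDeriv 3 (fun y => q y t) x = 0)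
      ↔ (∀ (x t : ℝ) (z : ℂ), z ≠ 0 →
          (Matrix.of fun i j => deriv (fun s => Xlax δ σ q₀ q x s z i j) t)
            - (Matrix.of fun i j => deriv (fun y => Tlax δ σ q₀ q y t z i j) x)
            + Xlax δ σ q₀ q x t z * Tlax δ σ q₀ q x t z
            - Tlax δ σ q₀ q x t z * Xlax δ σ q₀ q x t z = 0) := by
  constructor
  · intro h x t z _
    rw [aux_matrix σ δ q₀ q hq x t z, h x t]
    have h2 := h (-x) (-t)
    rw [neg_neg, neg_neg] at h2
    rw [h2]
    ext i j
    fin_cases i <;> fin_cases j <;> simp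
  · intro h x t
    have h1 := h x t 1 one_ne_zero
    rw [aux_matrix σ δ q₀ q hq x t 1] at h1
    have h2 := congrFun (congrFun h1 0) 1
    exact Complex.ofReal_eq_zero.1 h2
end

section
/- Let q : ℝ × ℝ → ℝ be smooth. For all (x,t) ∈ ℝ² and all z ∈ ℂ \ {0}, the first symmetry reduction holds: X(x,t;z) = −σ₄ · conj(X(−x,−t;−conj z)) · σ₄ and T(x,t;z) = −σ₄ · conj(T(−x,−t;−conj z)) · σ₄, where conj denotes entrywise complex conjugation of a matrix. -/
theorem aux_smooth (q : ℝ → ℝ → ℝ) (hq : ContDiff ℝ (⊤ : ℕ∞) fun p : ℝ × ℝ => q p.1 p.2) (t : ℝ) :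
    ContDiff ℝ (⊤ : ℕ∞) (fun y => q y t) :=
  hq.comp (contDiff_id.prodMk contDiff_const)

theorem aux_deriv (f : ℝ → ℝ) (hf : Differentiable ℝ f) (x : ℝ) :
    deriv (fun y => ((f y : ℝ) : ℂ)) x = ((deriv f x : ℝ) : ℂ) :=
  (hf x).hasDerivAt.ofReal_comp.deriv

theorem aux_deriv_neg (c : ℂ) (f : ℝ → ℝ) (hf : Differentiable ℝ f) (x : ℝ) :
    deriv (fun y => c * ((f (-y) : ℝ) : ℂ)) x = -(c * ((deriv f (-x) : ℝ) : ℂ)) := by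
  have h1 : HasDerivAt (fun y => f (-y)) (-(deriv f (-x))) x := by
    have h0 := (hf (-x)).hasDerivAt.comp x (hasDerivAt_neg x)
    rw [mul_neg_one] at h0
    exact h0
  have := (h1.ofReal_comp.const_mul c).deriv
  rw [this]; push_cast; ring

theorem aux_Qx (σ : ℝ) (q : ℝ → ℝ → ℝ)
    (hq : ContDiff ℝ (⊤ : ℕ∞) fun p : ℝ × ℝ => q p.1 p.2) (x t : ℝ) :
    Qxmat σ q x t = !![0, ((deriv (fun y => q y t) x : ℝ) : ℂ);
      -((σ : ℂ) * ((deriv (fun y => q y (-t)) (-x) : ℝ) : ℂ)), 0] := by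
  have h1 := aux_deriv _ ((aux_smooth q hq t).differentiable (by simp)) x
  have h2 := aux_deriv_neg σ _ ((aux_smooth q hq (-t)).differentiable (by simp)) x
  ext i j
  fin_cases i <;> fin_cases j <;> simp [Qxmat, Qmat] 
  · exact h1
  · simpa using h2

theorem aux_Qxx (σ : ℝ) (q : ℝ → ℝ → ℝ)
    (hq : ContDiff ℝ (⊤ : ℕ∞) fun p : ℝ × ℝ => q p.1 p.2) (x t : ℝ) :
    Qxxmat σ q x t = !![0, ((deriv (deriv (fun y => q y t)) x : ℝ) : ℂ);
      ((σ : ℂ) * ((deriv (deriv (fun y => q y (-t))) (-x) : ℝ) : ℂ)), 0] := by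
  have hd : ∀ s, Differentiable ℝ (deriv (fun y => q y s)) := fun s =>
    ((contDiff_infty_iff_deriv.1 (aux_smooth q hq s)).2).differentiable (by simp)
  have h1 := aux_deriv _ (hd t) x
  have h2 := aux_deriv_neg (-σ) _ (hd (-t)) x
  ext i j
  fin_cases i <;> fin_cases j <;> simp [Qxxmat, aux_Qx σ q hq]
  · exact h1
  · simpa using h2

theorem aux_map (a b c d : ℂ) (f : ℂ → ℂ) :
    (!![a, b; c, d] : Matrix (Fin 2) (Fin 2) ℂ).map f = !![f a, f b; f c, f d] := by
  ext i j
  fin_cases i <;> fin_cases j <;> rfl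

theorem aux_k (δ σ q₀ : ℝ) (z : ℂ) :
    (starRingEnd ℂ) (kfun δ σ q₀ (-(starRingEnd ℂ z))) = -kfun δ σ q₀ z := by
  simp [kfun, div_neg, Complex.conj_ofNat]; ring

/-- First symmetry reduction:
`X(x,t;z) = −σ₄ conj(X(−x,−t;−z̄)) σ₄` and `T(x,t;z) = −σ₄ conj(T(−x,−t;−z̄)) σ₄`,
where `σ₄ = σ₁` if `σ = −1` and `σ₄ = σ₂` if `σ = 1`. -/
theorem first_symmetry_reduction
    (q₀ δ σ : ℝ) (hq₀ : 0 < q₀) (hδ : δ = 1 ∨ δ = -1) (hσ : σ = 1 ∨ σ = -1)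
    (σ4 : Matrix (Fin 2) (Fin 2) ℂ)
    (hσ4 : (σ = -1 ∧ σ4 = pauli1) ∨ (σ = 1 ∧ σ4 = pauli2))
    (q : ℝ → ℝ → ℝ) (hq : ContDiff ℝ (⊤ : ℕ∞) fun p : ℝ × ℝ => q p.1 p.2) :
    ∀ (x t : ℝ) (z : ℂ), z ≠ 0 →
      Xlax δ σ q₀ q x t z
          = -(σ4 * (Xlax δ σ q₀ q (-x) (-t) (-(starRingEnd ℂ z))).map (starRingEnd ℂ) * σ4)
        ∧ Tlax δ σ q₀ q x t z
          = -(σ4 * (Tlax δ σ q₀ q (-x) (-t) (-(starRingEnd ℂ z))).map (starRingEnd ℂ) * σ4) := by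
  intro x t z _
  have hk := aux_k δ σ q₀ z
  have hII : Complex.I ^ 2 = -1 := Complex.I_sq
  have hI3 : Complex.I ^ 3 = -Complex.I := by rw [pow_succ, hII]; ring
  unfold Tlax Xlax
  rw [aux_Qx σ q hq, aux_Qxx σ q hq, aux_Qx σ q hq, aux_Qxx σ q hq]
  generalize kfun δ σ q₀ (-(starRingEnd ℂ z)) = k' at *
  generalize kfun δ σ q₀ z = k at *
  rcases hσ4 with ⟨rfl, rfl⟩ | ⟨rfl, rfl⟩ <;> constructor <;> ext i j <;>
    fin_cases i <;> fin_cases j <;>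
    simp [pauli1, pauli2, pauli3, Qmat, hk, aux_map, Complex.conj_ofNat] <;>
    ring_nf <;> try simp only [hII, hI3] <;> ring_nf
end

section
/- Let Ω ⊆ ℂ \ {0} be closed under z ↦ −conj z. Suppose for each z ∈ Ω there are invertible matrices Φ₊(x,t;z), Φ₋(x,t;z) ∈ Matrix (Fin 2) (Fin 2) ℂ and a matrix S(z) with det S(z) = 1 and Φ₊(x,t;z) = Φ₋(x,t;z) · S(z), and suppose the symmetries Φ₊(x,t;z) = σ₄ · conj(Φ₋(−x,−t;−conj z)) · σ₄ and Φ₋(x,t;z) = σ₄ · conj(Φ₊(−x,−t;−conj z)) · σ₄ hold for all (x,t) and z ∈ Ω. Then for all z ∈ Ω: S(z) = σ₄ · (conj(S(−conj z)))⁻¹ · σ₄; entrywise, s₁₁(z) = conj(s₁₁(−conj z)), s₂₂(z) = conj(s₂₂(−conj z)), s₁₂(z) = σ · conj(s₂₁(−conj z)), and s₂₁(z) = σ · conj(s₁₂(−conj z)). -/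
/-- First symmetry of the scattering matrix:
`S(z) = σ₄ (conj S(−z̄))⁻¹ σ₄`, i.e. `s₁₁(z) = conj s₁₁(−z̄)`,
`s₂₂(z) = conj s₂₂(−z̄)`, `s₁₂(z) = σ conj s₂₁(−z̄)`, `s₂₁(z) = σ conj s₁₂(−z̄)`. -/
theorem first_symmetry_scattering
    (σ : ℝ) (hσ : σ = 1 ∨ σ = -1)
    (σ4 : Matrix (Fin 2) (Fin 2) ℂ)
    (hσ4 : (σ = -1 ∧ σ4 = pauli1) ∨ (σ = 1 ∧ σ4 = pauli2))
    (Ω : Set ℂ) (hΩ0 : (0 : ℂ) ∉ Ω) (hΩc : ∀ z ∈ Ω, -(starRingEnd ℂ z) ∈ Ω)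
    (Φp Φm : ℝ → ℝ → ℂ → Matrix (Fin 2) (Fin 2) ℂ)
    (S : ℂ → Matrix (Fin 2) (Fin 2) ℂ)
    (hinv : ∀ (x t : ℝ), ∀ z ∈ Ω, IsUnit (Φp x t z) ∧ IsUnit (Φm x t z))
    (hdet : ∀ z ∈ Ω, (S z).det = 1)
    (hS : ∀ (x t : ℝ), ∀ z ∈ Ω, Φp x t z = Φm x t z * S z)
    (hsym1 : ∀ (x t : ℝ), ∀ z ∈ Ω,
      Φp x t z = σ4 * (Φm (-x) (-t) (-(starRingEnd ℂ z))).map (starRingEnd ℂ) * σ4)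
    (hsym2 : ∀ (x t : ℝ), ∀ z ∈ Ω,
      Φm x t z = σ4 * (Φp (-x) (-t) (-(starRingEnd ℂ z))).map (starRingEnd ℂ) * σ4) :
    ∀ z ∈ Ω,
      S z = σ4 * ((S (-(starRingEnd ℂ z))).map (starRingEnd ℂ))⁻¹ * σ4
      ∧ S z 0 0 = starRingEnd ℂ (S (-(starRingEnd ℂ z)) 0 0)
      ∧ S z 1 1 = starRingEnd ℂ (S (-(starRingEnd ℂ z)) 1 1)
      ∧ S z 0 1 = (σ : ℂ) * starRingEnd ℂ (S (-(starRingEnd ℂ z)) 1 0)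
      ∧ S z 1 0 = (σ : ℂ) * starRingEnd ℂ (S (-(starRingEnd ℂ z)) 0 1) := by
  intro z hz
  have hz' := hΩc z hz
  have hsq : σ4 * σ4 = 1 := by
    rcases hσ4 with ⟨_, rfl⟩ | ⟨_, rfl⟩
    · ext i j; fin_cases i <;> fin_cases j <;> simp [pauli1, Matrix.mul_apply]
    · ext i j; fin_cases i <;> fin_cases j <;> simp [pauli2, Matrix.mul_apply]
  have hd := hdet _ hz'
  have h1 := hsym1 0 0 z hz
  have h2 := hsym2 0 0 z hz
  rw [hS _ _ _ hz', Matrix.map_mul] at h2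
  have hTd : ((S (-(starRingEnd ℂ z))).map (starRingEnd ℂ)).det = 1 := by
    have := (starRingEnd ℂ).map_det (S (-(starRingEnd ℂ z)))
    rw [hd, map_one] at this
    exact this.symm
  have hTu : IsUnit ((S (-(starRingEnd ℂ z))).map (starRingEnd ℂ)).det := by
    rw [hTd]; exact isUnit_one
  have key : S z = σ4 * ((S (-(starRingEnd ℂ z))).map (starRingEnd ℂ))⁻¹ * σ4 := by
    apply (hinv 0 0 z hz).2.mul_left_cancel
    rw [← hS 0 0 z hz, h1, h2]
    generalize (S (-(starRingEnd ℂ z))).map (starRingEnd ℂ) = T at *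
    generalize (Φm (-0) (-0) (-(starRingEnd ℂ z))).map (starRingEnd ℂ) = M
    symm
    calc σ4 * (M * T) * σ4 * (σ4 * T⁻¹ * σ4)
        = σ4 * M * T * (σ4 * σ4) * T⁻¹ * σ4 := by simp only [Matrix.mul_assoc]
      _ = σ4 * M * (T * T⁻¹) * σ4 := by rw [hsq]; simp only [Matrix.mul_assoc, Matrix.one_mul]
      _ = σ4 * M * σ4 := by rw [Matrix.mul_nonsing_inv _ hTu, Matrix.mul_one]
  refine ⟨key, ?_⟩
  rw [Matrix.inv_def, hTd, Matrix.adjugate_fin_two] at key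
  rw [key]
  rcases hσ4 with ⟨rfl, rfl⟩ | ⟨rfl, rfl⟩
  · simp [pauli1, Matrix.mul_apply]
  · have hI : ∀ w : ℂ, Complex.I * w * Complex.I = -w := by
      intro w; linear_combination w * Complex.I_mul_I
    simp [pauli2, Matrix.mul_apply, hI]
end

section
/- Let Ω ⊆ ℂ \ {0} be closed under z ↦ δσ q₀²/z. Suppose for each z ∈ Ω there are matrices Φ₊(x,t;z), Φ₋(x,t;z) ∈ Matrix (Fin 2) (Fin 2) ℂ with Φ₋(x,t;z) invertible, a matrix S(z) with Φ₊(x,t;z) = Φ₋(x,t;z) · S(z), and the symmetries Φ±(x,t;z) = (i/z) · Φ±(x,t; δσ q₀²/z) · σ₃ Q± hold for all (x,t) and z ∈ Ω. Then S(z) = (σ₃ Q₋)⁻¹ · S(δσ q₀²/z) · (σ₃ Q₊) for all z ∈ Ω; entrywise, s₁₁(z) = δ s₂₂(δσ q₀²/z) and s₁₂(z) = −σ s₂₁(δσ q₀²/z). -/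
/-- `Q₋ = [[0, q₋], [δσ q₋, 0]]`. -/
noncomputable def Qminus (δ σ qm : ℝ) : Matrix (Fin 2) (Fin 2) ℂ :=
  !![0, (qm : ℂ); (δ : ℂ) * (σ : ℂ) * (qm : ℂ), 0]

/-- `Q₊ = [[0, q₊], [δσ q₊, 0]]` with `q₊ = δ q₋`. -/
noncomputable def Qplus (δ σ qm : ℝ) : Matrix (Fin 2) (Fin 2) ℂ :=
  !![0, (δ : ℂ) * (qm : ℂ); (δ : ℂ) * (σ : ℂ) * ((δ : ℂ) * (qm : ℂ)), 0]

/-- Third symmetry of the scattering matrix: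
`S(z) = (σ₃Q₋)⁻¹ S(δσq₀²/z) (σ₃Q₊)`, entrywise `s₁₁(z) = δ s₂₂(δσq₀²/z)` and
`s₁₂(z) = −σ s₂₁(δσq₀²/z)`. -/
theorem third_symmetry_scattering
    (q₀ δ σ qm : ℝ) (hq₀ : 0 < q₀) (hδ : δ = 1 ∨ δ = -1) (hσ : σ = 1 ∨ σ = -1)
    (hqm : qm = q₀ ∨ qm = -q₀)
    (Ω : Set ℂ) (hΩ0 : (0 : ℂ) ∉ Ω)
    (hΩc : ∀ z ∈ Ω, (δ : ℂ) * (σ : ℂ) * (q₀ : ℂ) ^ 2 / z ∈ Ω)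
    (Φp Φm : ℝ → ℝ → ℂ → Matrix (Fin 2) (Fin 2) ℂ)
    (S : ℂ → Matrix (Fin 2) (Fin 2) ℂ)
    (hinv : ∀ (x t : ℝ), ∀ z ∈ Ω, IsUnit (Φm x t z))
    (hS : ∀ (x t : ℝ), ∀ z ∈ Ω, Φp x t z = Φm x t z * S z)
    (hsymp : ∀ (x t : ℝ), ∀ z ∈ Ω,
      Φp x t z = (Complex.I / z) •
        (Φp x t ((δ : ℂ) * (σ : ℂ) * (q₀ : ℂ) ^ 2 / z) * (pauli3 * Qplus δ σ qm)))
    (hsymm : ∀ (x t : ℝ), ∀ z ∈ Ω,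
      Φm x t z = (Complex.I / z) •
        (Φm x t ((δ : ℂ) * (σ : ℂ) * (q₀ : ℂ) ^ 2 / z) * (pauli3 * Qminus δ σ qm))) :
    ∀ z ∈ Ω,
      S z = (pauli3 * Qminus δ σ qm)⁻¹ *
              S ((δ : ℂ) * (σ : ℂ) * (q₀ : ℂ) ^ 2 / z) * (pauli3 * Qplus δ σ qm)
      ∧ S z 0 0 = (δ : ℂ) * S ((δ : ℂ) * (σ : ℂ) * (q₀ : ℂ) ^ 2 / z) 1 1
      ∧ S z 0 1 = -(σ : ℂ) * S ((δ : ℂ) * (σ : ℂ) * (q₀ : ℂ) ^ 2 / z) 1 0 := by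
  intro z hz
  have hz0 : z ≠ 0 := fun h => hΩ0 (h ▸ hz)
  have hw := hΩc z hz
  have h1 := hsymp 0 0 z hz
  have h2 := hsymm 0 0 z hz
  generalize (δ : ℂ) * (σ : ℂ) * (q₀ : ℂ) ^ 2 / z = w at hw h1 h2 ⊢
  have hSw := hS 0 0 w hw
  have hSz := hS 0 0 z hz
  have hc : Complex.I / z ≠ 0 := div_ne_zero Complex.I_ne_zero hz0
  have key : (pauli3 * Qminus δ σ qm) * S z = S w * (pauli3 * Qplus δ σ qm) := by
    rw [h1, hSw, h2, Matrix.smul_mul] at hSz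
    have h3 := smul_right_injective _ hc hSz
    simp only [Matrix.mul_assoc] at h3
    have h4 := (hinv 0 0 w hw).mul_left_cancel h3
    simp only [Matrix.mul_assoc]
    exact h4.symm
  have hq : (qm : ℂ) ≠ 0 := by
    have : qm ≠ 0 := by rcases hqm with h | h <;> rw [h] <;> simp [hq₀.ne']
    exact_mod_cast this
  have hd : (δ : ℂ) * δ = 1 := by rcases hδ with h | h <;> simp [h]
  have hs : (σ : ℂ) * σ = 1 := by rcases hσ with h | h <;> simp [h]
  have hdet : IsUnit (pauli3 * Qminus δ σ qm).det := by
    have hd0 : (δ : ℂ) ≠ 0 := left_ne_zero_of_mul_eq_one hd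
    have hs0 : (σ : ℂ) ≠ 0 := left_ne_zero_of_mul_eq_one hs
    simp [pauli3, Qminus, Matrix.det_fin_two, hq, hd0, hs0]
  refine ⟨?_, ?_, ?_⟩
  · rw [Matrix.mul_assoc, ← key, ← Matrix.mul_assoc, Matrix.nonsing_inv_mul _ hdet, Matrix.one_mul]
  · have h := congrFun (congrFun key 1) 0
    simp [pauli3, Qminus, Qplus, Matrix.mul_apply, Fin.sum_univ_two] at h
    apply mul_left_cancel₀ hq
    linear_combination (δ * σ : ℂ) * h + (-(qm:ℂ) * S z 0 0 * σ * σ + δ * σ * σ * qm * S w 1 1) * hd + (-(qm:ℂ) * S z 0 0 + δ * qm * S w 1 1) * hs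
  · have h := congrFun (congrFun key 1) 1
    simp [pauli3, Qminus, Qplus, Matrix.mul_apply, Fin.sum_univ_two] at h
    apply mul_left_cancel₀ hq
    linear_combination (-δ * σ : ℂ) * h + (-(qm:ℂ) * S z 0 1 * σ * σ - σ * qm * S w 1 0) * hd - (qm:ℂ) * S z 0 1 * hs
end

section
/- Fix z₀ ∈ ℂ \ {0} and set ẑ₀ = δσ q₀²/z₀. Suppose for z ∈ {z₀, ẑ₀} there are matrices Φ₊(x,t;z), Φ₋(x,t;z) ∈ Matrix (Fin 2) (Fin 2) ℂ whose columns satisfy the third symmetry Φ_{±j}(x,t;z) = (−δσ)^j · (i q±/z) · Φ_{±(3−j)}(x,t; δσ q₀²/z) for j = 1, 2 and all (x,t). Suppose further that there are constants b[z₀], b[ẑ₀] ∈ ℂ and some (x,t) at which Φ₋₂(x,t;z₀) is nonzero, such that Φ₊₁(x,t;z₀) = b[z₀] · Φ₋₂(x,t;z₀) and Φ₊₂(x,t;ẑ₀) = b[ẑ₀] · Φ₋₁(x,t;ẑ₀) hold for all (x,t). Then b[z₀] = −σ · b[ẑ₀]. -/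
/-- Symmetry of the norming constants from the third symmetry of the Jost solutions:
`b[z₀] = −σ b[ẑ₀]` with `ẑ₀ = δσ q₀²/z₀`.  Here the columns of `Φ±` satisfy
`Φ_{±j}(x,t;z) = (−δσ)^j (i q±/z) Φ_{±(3−j)}(x,t;δσq₀²/z)` for `z ∈ {z₀, ẑ₀}`,
with `q₋ = qm` and `q₊ = δ qm`. -/
theorem b_symmetry_third
    (q₀ δ σ qm : ℝ) (hq₀ : 0 < q₀) (hδ : δ = 1 ∨ δ = -1) (hσ : σ = 1 ∨ σ = -1)
    (hqm : qm = q₀ ∨ qm = -q₀)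
    (z₀ : ℂ) (hz₀ : z₀ ≠ 0)
    (Φp Φm : ℝ → ℝ → ℂ → Matrix (Fin 2) (Fin 2) ℂ)
    (hsymp1 : ∀ (x t : ℝ),
      ∀ z ∈ ({z₀, (δ : ℂ) * (σ : ℂ) * (q₀ : ℂ) ^ 2 / z₀} : Set ℂ), ∀ i : Fin 2,
      Φp x t z i 0 = (-((δ : ℂ) * (σ : ℂ))) ^ (1 : ℕ) *
        (Complex.I * ((δ : ℂ) * (qm : ℂ)) / z) *
        Φp x t ((δ : ℂ) * (σ : ℂ) * (q₀ : ℂ) ^ 2 / z) i 1)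
    (hsymp2 : ∀ (x t : ℝ),
      ∀ z ∈ ({z₀, (δ : ℂ) * (σ : ℂ) * (q₀ : ℂ) ^ 2 / z₀} : Set ℂ), ∀ i : Fin 2,
      Φp x t z i 1 = (-((δ : ℂ) * (σ : ℂ))) ^ (2 : ℕ) *
        (Complex.I * ((δ : ℂ) * (qm : ℂ)) / z) *
        Φp x t ((δ : ℂ) * (σ : ℂ) * (q₀ : ℂ) ^ 2 / z) i 0)
    (hsymm1 : ∀ (x t : ℝ),
      ∀ z ∈ ({z₀, (δ : ℂ) * (σ : ℂ) * (q₀ : ℂ) ^ 2 / z₀} : Set ℂ), ∀ i : Fin 2,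
      Φm x t z i 0 = (-((δ : ℂ) * (σ : ℂ))) ^ (1 : ℕ) *
        (Complex.I * (qm : ℂ) / z) *
        Φm x t ((δ : ℂ) * (σ : ℂ) * (q₀ : ℂ) ^ 2 / z) i 1)
    (hsymm2 : ∀ (x t : ℝ),
      ∀ z ∈ ({z₀, (δ : ℂ) * (σ : ℂ) * (q₀ : ℂ) ^ 2 / z₀} : Set ℂ), ∀ i : Fin 2,
      Φm x t z i 1 = (-((δ : ℂ) * (σ : ℂ))) ^ (2 : ℕ) *
        (Complex.I * (qm : ℂ) / z) *
        Φm x t ((δ : ℂ) * (σ : ℂ) * (q₀ : ℂ) ^ 2 / z) i 0)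
    (b0 bh : ℂ)
    (hnz : ∃ (x t : ℝ) (i : Fin 2), Φm x t z₀ i 1 ≠ 0)
    (hb0 : ∀ (x t : ℝ) (i : Fin 2), Φp x t z₀ i 0 = b0 * Φm x t z₀ i 1)
    (hbh : ∀ (x t : ℝ) (i : Fin 2),
      Φp x t ((δ : ℂ) * (σ : ℂ) * (q₀ : ℂ) ^ 2 / z₀) i 1
        = bh * Φm x t ((δ : ℂ) * (σ : ℂ) * (q₀ : ℂ) ^ 2 / z₀) i 0) :
    b0 = -(σ : ℂ) * bh := by
  obtain ⟨x, t, i, hne⟩ := hnz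
  have h1 := hsymp1 x t z₀ (by simp) i
  have h2 := hsymm2 x t z₀ (by simp) i
  rw [hb0, hbh] at h1
  have hd : (δ : ℂ) ^ 2 = 1 := by
    rcases hδ with h | h <;> simp [h]
  have hs : (σ : ℂ) ^ 2 = 1 := by
    rcases hσ with h | h <;> simp [h]
  have hds : (-((δ : ℂ) * (σ : ℂ))) ^ 2 = 1 := by
    rw [neg_sq, mul_pow, hd, hs, one_mul]
  rw [hds] at h2
  apply mul_right_cancel₀ hne
  rw [h1, h2]
  generalize Φm x t ((δ : ℂ) * (σ : ℂ) * (q₀ : ℂ) ^ 2 / z₀) i 0 = M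
  simp only [div_eq_mul_inv]
  linear_combination (-(σ : ℂ) * Complex.I * qm * z₀⁻¹ * bh * M) * hd
end

section
/- Let q₀ > 0, ε ∈ {1, −1}, and define q : ℝ × ℝ → ℝ by q(x,t) = −ε q₀ tanh(q₀ (x + 2 q₀² t)). Then q satisfies the focusing nonlocal mKdV equation with σ = −1, i.e. q_t(x,t) + 6 q(−x,−t) q(x,t) q_x(x,t) + q_{xxx}(x,t) = 0 for all (x,t) ∈ ℝ², and q has the non-zero boundary values lim_{x→+∞} q(x,t) = −ε q₀ and lim_{x→−∞} q(x,t) = ε q₀ for every fixed t (so q₊ = −q₋ and δ = −1, |q±| = q₀). -/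
/-- The one-eigenvalue kink soliton `q(x,t) = −ε q₀ tanh(q₀(x + 2q₀²t))`. -/
noncomputable def kinkq (q₀ ε : ℝ) (x t : ℝ) : ℝ :=
  -ε * q₀ * Real.tanh (q₀ * (x + 2 * q₀ ^ 2 * t))

theorem aux_tanh_deriv (x : ℝ) : HasDerivAt Real.tanh (1 - Real.tanh x ^ 2) x := by
  have h := (Real.hasDerivAt_sinh x).div (Real.hasDerivAt_cosh x) (Real.cosh_pos x).ne'
  have e : Real.tanh = Real.sinh / Real.cosh := by
    funext y
    simp [Real.tanh_eq_sinh_div_cosh]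
  rw [← e] at h
  refine h.congr_deriv ?_
  have := (Real.cosh_pos x).ne'
  rw [Real.tanh_eq_sinh_div_cosh]
  field_simp

theorem aux_tanh_atTop : Filter.Tendsto Real.tanh Filter.atTop (nhds 1) := by
  have e : Real.tanh = fun x => (1 - Real.exp (-x) ^ 2) / (1 + Real.exp (-x) ^ 2) := by
    funext x
    rw [Real.tanh_eq, Real.exp_neg]
    have := Real.exp_pos x
    field_simp
  have h := Real.tendsto_exp_neg_atTop_nhds_zero.pow 2
  rw [e]
  have := (h.const_sub 1).div (h.const_add 1) (by norm_num)
  have h2 : (1 - (0:ℝ) ^ 2) / (1 + 0 ^ 2) = 1 := by norm_num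
  rw [h2] at this
  exact this

theorem aux_tanh_atBot : Filter.Tendsto Real.tanh Filter.atBot (nhds (-1)) := by
  have h := (aux_tanh_atTop.comp Filter.tendsto_neg_atBot_atTop).neg
  refine h.congr fun x => ?_
  simp [Real.tanh_neg]

/-- The kink `q(x,t) = −ε q₀ tanh(q₀(x + 2q₀²t))` solves the focusing (`σ = −1`)
nonlocal mKdV equation `q_t + 6 q(−x,−t) q(x,t) q_x + q_{xxx} = 0` and has the
non-zero boundary values `q → −ε q₀` as `x → +∞` and `q → ε q₀` as `x → −∞`. -/
theorem kink_soliton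
    (q₀ ε : ℝ) (hq₀ : 0 < q₀) (hε : ε = 1 ∨ ε = -1) :
    (∀ x t : ℝ,
      deriv (fun s => kinkq q₀ ε x s) t
        + 6 * kinkq q₀ ε (-x) (-t) * kinkq q₀ ε x t * deriv (fun y => kinkq q₀ ε y t) x
        + iteratedDeriv 3 (fun y => kinkq q₀ ε y t) x = 0)
    ∧ (∀ t : ℝ,
        Filter.Tendsto (fun x => kinkq q₀ ε x t) Filter.atTop (nhds (-ε * q₀))
        ∧ Filter.Tendsto (fun x => kinkq q₀ ε x t) Filter.atBot (nhds (ε * q₀))) := by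
  have hlin : ∀ x t : ℝ, HasDerivAt (fun y : ℝ => q₀ * (y + 2 * q₀ ^ 2 * t)) q₀ x := by
    intro x t
    simpa using ((hasDerivAt_id x).add_const (2 * q₀ ^ 2 * t)).const_mul q₀
  have hT : ∀ x t : ℝ, HasDerivAt (fun y : ℝ => Real.tanh (q₀ * (y + 2 * q₀ ^ 2 * t)))
      ((1 - Real.tanh (q₀ * (x + 2 * q₀ ^ 2 * t)) ^ 2) * q₀) x := fun x t =>
    (aux_tanh_deriv _).comp x (hlin x t)
  refine ⟨fun x t => ?_, fun t => ⟨?_, ?_⟩⟩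
  · have h1 : deriv (fun y => kinkq q₀ ε y t) = fun y =>
        -ε * q₀ * ((1 - Real.tanh (q₀ * (y + 2 * q₀ ^ 2 * t)) ^ 2) * q₀) := by
      funext y
      exact ((hT y t).const_mul (-ε * q₀)).deriv
    have h2 : deriv (fun y => -ε * q₀ * ((1 - Real.tanh (q₀ * (y + 2 * q₀ ^ 2 * t)) ^ 2) * q₀))
        = fun y => -ε * q₀ * (-(2 * Real.tanh (q₀ * (y + 2 * q₀ ^ 2 * t)) *
          ((1 - Real.tanh (q₀ * (y + 2 * q₀ ^ 2 * t)) ^ 2) * q₀)) * q₀) := by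
      funext y
      have := (((((hT y t).pow 2).const_sub 1).mul_const q₀).const_mul (-ε * q₀)).deriv
      simpa using this
    have h3 : deriv (fun y => -ε * q₀ * (-(2 * Real.tanh (q₀ * (y + 2 * q₀ ^ 2 * t)) *
          ((1 - Real.tanh (q₀ * (y + 2 * q₀ ^ 2 * t)) ^ 2) * q₀)) * q₀)) x =
        -ε * q₀ ^ 4 * (1 - Real.tanh (q₀ * (x + 2 * q₀ ^ 2 * t)) ^ 2) *
          (-2 + 6 * Real.tanh (q₀ * (x + 2 * q₀ ^ 2 * t)) ^ 2) := by
      have := (((((hT x t).const_mul 2).mul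
        ((((hT x t).pow 2).const_sub 1).mul_const q₀)).neg.mul_const q₀).const_mul (-ε * q₀)).deriv
      refine Eq.trans this ?_
      simp
      ring
    have h0 : deriv (fun s => kinkq q₀ ε x s) t =
        -ε * q₀ * ((1 - Real.tanh (q₀ * (x + 2 * q₀ ^ 2 * t)) ^ 2) * (q₀ * (2 * q₀ ^ 2))) := by
      have hl : HasDerivAt (fun s : ℝ => q₀ * (x + 2 * q₀ ^ 2 * s)) (q₀ * (2 * q₀ ^ 2)) t := by
        simpa using (((hasDerivAt_id t).const_mul (2 * q₀ ^ 2)).const_add x).const_mul q₀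
      exact (((aux_tanh_deriv _).comp t hl).const_mul (-ε * q₀)).deriv
    have hn : kinkq q₀ ε (-x) (-t) = - kinkq q₀ ε x t := by
      have : q₀ * (-x + 2 * q₀ ^ 2 * -t) = -(q₀ * (x + 2 * q₀ ^ 2 * t)) := by ring
      simp only [kinkq, this, Real.tanh_neg]
      ring
    have h4 : iteratedDeriv 3 (fun y => kinkq q₀ ε y t) x = deriv (deriv (deriv
        (fun y => kinkq q₀ ε y t))) x := by
      simp only [iteratedDeriv_succ, iteratedDeriv_zero]
    rw [h4, h0, hn, h1, h2, h3]
    simp only [kinkq]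
    rcases hε with rfl | rfl <;> ring
  · have hl : Filter.Tendsto (fun x : ℝ => q₀ * (x + 2 * q₀ ^ 2 * t)) Filter.atTop Filter.atTop :=
      (Filter.tendsto_atTop_add_const_right _ _ Filter.tendsto_id).const_mul_atTop hq₀
    simpa [kinkq] using (aux_tanh_atTop.comp hl).const_mul (-ε * q₀)
  · have hl : Filter.Tendsto (fun x : ℝ => q₀ * (x + 2 * q₀ ^ 2 * t)) Filter.atBot Filter.atBot :=
      (Filter.tendsto_atBot_add_const_right _ _ Filter.tendsto_id).const_mul_atBot hq₀
    simpa [kinkq] using (aux_tanh_atBot.comp hl).const_mul (-ε * q₀)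
end
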